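/- Let β ∈ (1,∞), α ∈ (1,2] with α < β, and γ = α/(α−1). Let L_β be the operator generated by the power-type kernel k_β(j) = |j|^{−(1+β)} (j ≠ 0), k_β(0) = 0. Then there exists a constant d > 0 such that for every bounded u: ℤ → ℝ and every x ∈ ℤ one has Ψ_{2,Υ}(u)(x) ≥ (1/d)·|L_β u(x)|^γ; in particular, L_β satisfies CD_Υ(0,F) with CD-function F(r) = (1/d)·r^γ. -/

import Mathlib

open scoped BigOperators
open Filter Set

noncomputable section

/-- `Υ(r) = e^r − 1 − r`. -/
def Ups (r : ℝ) : ℝ := Real.exp r - 1 - r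

/-- `H(x) = (1/2) e^{−x} Υ(2x)`. -/
def Hfun (x : ℝ) : ℝ := (1 / 2) * Real.exp (-x) * Ups (2 * x)

/-- The long-range jump operator `L u (x) = ∑_{j∈ℤ} k(j)(u(x+j) − u(x))`. -/
def Lop (k : ℤ → ℝ) (u : ℤ → ℝ) (x : ℤ) : ℝ := ∑' j : ℤ, k j * (u (x + j) - u x)

/-- `Ψ_Υ(u)(x) = ∑_{j∈ℤ} k(j) Υ(u(x+j) − u(x))`. -/
def PsiUps (k : ℤ → ℝ) (u : ℤ → ℝ) (x : ℤ) : ℝ := ∑' j : ℤ, k j * Ups (u (x + j) - u x)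

/-- `Ψ_{2,Υ}(u)(x)`. -/
def Psi2 (k : ℤ → ℝ) (u : ℤ → ℝ) (x : ℤ) : ℝ :=
  (1 / 2) * ∑' p : ℤ × ℤ, k p.1 * k p.2 * Real.exp (u (x + p.2) - u x) *
    Ups (u (x + p.1 + p.2) - u (x + p.1) - u (x + p.2) + u x)

/-- A bounded function on `ℤ`. -/
def BddFun (u : ℤ → ℝ) : Prop := ∃ M : ℝ, ∀ x : ℤ, |u x| ≤ M

/-- A nontrivial symmetric integrable kernel on `ℤ` vanishing at `0`. -/
structure IsKernel (k : ℤ → ℝ) : Prop where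
  nonneg : ∀ j, 0 ≤ k j
  zero_at_zero : k 0 = 0
  symm : ∀ j, k (-j) = k j
  summable : Summable k
  nontrivial : ∃ j, k j ≠ 0

/-- A CD-function: continuous on `[0,∞)`, nonnegative, `F(0)=0`, `r ↦ F(r)/r` strictly
increasing on `(0,∞)` and `1/F` integrable at `∞`. -/
def IsCDFunction (F : ℝ → ℝ) : Prop :=
  ContinuousOn F (Ici 0) ∧ (∀ r, 0 ≤ r → 0 ≤ F r) ∧ F 0 = 0 ∧
    StrictMonoOn (fun r => F r / r) (Ioi 0) ∧
    ∃ a, 0 < a ∧ MeasureTheory.IntegrableOn (fun r => 1 / F r) (Ici a)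

/-- The curvature-dimension condition `CD_Υ(0,F)` for the operator generated by `k`. -/
def CDUps (k : ℤ → ℝ) (F : ℝ → ℝ) : Prop :=
  ∀ u : ℤ → ℝ, BddFun u → ∀ x : ℤ, 0 ≤ -Lop k u x → F (-Lop k u x) ≤ Psi2 k u x

/-- The power-type kernel `k_β(j) = |j|^{−(1+β)}` for `j ≠ 0`, `k_β(0) = 0`. -/
def kpow (β : ℝ) (j : ℤ) : ℝ := if j = 0 then 0 else |(j : ℝ)| ^ (-(1 + β))

lemma aux_Ups_nonneg (r : ℝ) : 0 ≤ Ups r := by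
  unfold Ups; linarith [Real.add_one_le_exp r]

lemma aux_Ups_pos (r : ℝ) (hr : 0 ≤ r) : Real.exp (7 * r / 8) * (r ^ 2 / 128) ≤ Ups r := by
  obtain ⟨y, rfl⟩ : ∃ y, r = 8 * y := ⟨r / 8, by ring⟩
  have hy : 0 ≤ y := by linarith
  have h1 : Real.exp (8 * y) = Real.exp (7 * y) * Real.exp y := by
    rw [← Real.exp_add]; ring_nf
  have h2 := Real.quadratic_le_exp_of_nonneg hy
  have h3 := Real.add_one_le_exp (7 * y)
  have h4 : (7 * (8 * y) / 8) = 7 * y := by ring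
  unfold Ups
  rw [h4, h1]
  have h5 := mul_le_mul_of_nonneg_left h2 (Real.exp_pos (7 * y)).le
  have h6 := mul_le_mul_of_nonneg_right h3 (by linarith : 0 ≤ 1 + y)
  nlinarith

lemma aux_Ups_neg (q : ℝ) (hq : 0 ≤ q) : q ^ 2 / 128 ≤ Real.exp (q / 8) * Ups (-q) := by
  rcases le_total q 2 with h | h
  · have h1 := Real.add_one_le_exp (-(q / 2))
    have h2 : Real.exp (-q) = Real.exp (-(q / 2)) ^ 2 := by
      rw [← Real.exp_nat_mul]; ring_nf
    have h3 : q ^ 2 / 4 ≤ Ups (-q) := by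
      unfold Ups; rw [h2]; nlinarith
    have h4 := Real.one_le_exp (by linarith : 0 ≤ q / 8)
    nlinarith [sq_nonneg q]
  · have h3 : q / 2 ≤ Ups (-q) := by
      unfold Ups; linarith [Real.exp_pos (-q)]
    have h4 := Real.add_one_le_exp (q / 8)
    have := mul_le_mul (by linarith : q / 8 ≤ Real.exp (q / 8)) h3 (by linarith)
      (Real.exp_pos _).le
    nlinarith [sq_nonneg q]

lemma aux_low (s r : ℝ) (h : -(r / 2) - |r| / 4 ≤ s) :
    Real.exp (|r| / 8) * (r ^ 2 / 128) ≤ Real.exp s * Ups r := by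
  rcases le_total 0 r with hr | hr
  · rw [abs_of_nonneg hr] at h ⊢
    have h1 := aux_Ups_pos r hr
    have h2 : Real.exp (-(3 * r / 4)) ≤ Real.exp s := Real.exp_le_exp.2 (by linarith)
    have h3 : Real.exp (r / 8) = Real.exp (-(3 * r / 4)) * Real.exp (7 * r / 8) := by
      rw [← Real.exp_add]; ring_nf
    rw [h3, mul_assoc]
    exact mul_le_mul h2 h1 (by positivity) (Real.exp_pos _).le
  · rw [abs_of_nonpos hr] at h ⊢
    have h1 := aux_Ups_neg (-r) (by linarith)
    rw [neg_neg] at h1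
    have h2 : Real.exp (-r / 4) ≤ Real.exp s := Real.exp_le_exp.2 (by linarith)
    have h3 : Real.exp (-r / 4) = Real.exp (-r / 8) * Real.exp (-r / 8) := by
      rw [← Real.exp_add]; ring_nf
    calc Real.exp (-r / 8) * (r ^ 2 / 128)
        ≤ Real.exp (-r / 8) * (Real.exp (-r / 8) * Ups r) := by
          apply mul_le_mul_of_nonneg_left _ (Real.exp_pos _).le
          simpa using h1
      _ = Real.exp (-r / 4) * Ups r := by rw [h3]; ring
      _ ≤ _ := mul_le_mul_of_nonneg_right h2 (aux_Ups_nonneg r)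

lemma aux_A (γ : ℝ) (hγ : 2 ≤ γ) : ∃ A : ℝ, 0 < A ∧ ∀ s r : ℝ,
    -(r / 2) - |r| / 4 ≤ s → |r| ^ γ ≤ A * (Real.exp s * Ups r) := by
  obtain ⟨n, hn⟩ := exists_nat_ge (γ - 2)
  refine ⟨128 * (1 + n.factorial * 8 ^ n), by positivity, fun s r h => ?_⟩
  have h1 := aux_low s r h
  have hy : 0 ≤ |r| := abs_nonneg r
  have h2 : |r| ^ (γ - 2) ≤ (1 + n.factorial * 8 ^ n) * Real.exp (|r| / 8) := by
    have he := Real.one_le_exp (by positivity : 0 ≤ |r| / 8)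
    have hp := Real.pow_div_factorial_le_exp (|r| / 8) (by positivity) n
    rw [div_le_iff₀ (by positivity), div_pow, div_le_iff₀ (by positivity)] at hp
    rcases le_total |r| 1 with h | h
    · have := Real.rpow_le_one hy h (by linarith : 0 ≤ γ - 2)
      have : 0 ≤ (n.factorial * 8 ^ n : ℝ) * Real.exp (|r| / 8) := by positivity
      linarith
    · have := Real.rpow_le_rpow_of_exponent_le h hn
      rw [Real.rpow_natCast] at this
      nlinarith
  have h3 : |r| ^ γ = |r| ^ (γ - 2) * r ^ 2 := by
    rcases eq_or_lt_of_le hy with h0 | h0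
    · rw [← h0, Real.zero_rpow (by linarith)]
      have : r = 0 := by simpa using h0.symm
      simp [this]
    · rw [← sq_abs r, ← Real.rpow_natCast, ← Real.rpow_add h0]; norm_num
  rw [h3]
  calc |r| ^ (γ - 2) * r ^ 2 ≤ (1 + n.factorial * 8 ^ n) * Real.exp (|r| / 8) * r ^ 2 :=
        mul_le_mul_of_nonneg_right h2 (sq_nonneg r)
    _ = 128 * (1 + n.factorial * 8 ^ n) * (Real.exp (|r| / 8) * (r ^ 2 / 128)) := by ring
    _ ≤ _ := mul_le_mul_of_nonneg_left h1 (by positivity)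

lemma aux_two (γ : ℝ) (hγ : 2 ≤ γ) (a b : ℝ) (ha : 0 ≤ a) (hb : 0 ≤ b) :
    (a + b) ^ γ ≤ 2 ^ γ * (a ^ γ + b ^ γ) := by
  have h0a := Real.rpow_nonneg ha γ
  have h0b := Real.rpow_nonneg hb γ
  have h2 : (0:ℝ) ≤ 2 ^ γ := by positivity
  rcases le_total a b with h | h
  · calc (a + b) ^ γ ≤ (2 * b) ^ γ := Real.rpow_le_rpow (by linarith) (by linarith) (by linarith)
      _ = 2 ^ γ * b ^ γ := Real.mul_rpow (by norm_num) hb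
      _ ≤ _ := mul_le_mul_of_nonneg_left (by linarith) h2
  · calc (a + b) ^ γ ≤ (2 * a) ^ γ := Real.rpow_le_rpow (by linarith) (by linarith) (by linarith)
      _ = 2 ^ γ * a ^ γ := Real.mul_rpow (by norm_num) ha
      _ ≤ _ := mul_le_mul_of_nonneg_left (by linarith) h2

lemma aux_pt (γ : ℝ) (hγ : 2 ≤ γ) : ∃ C : ℝ, 0 < C ∧ ∀ a b : ℝ,
    (|a - b| ^ γ ≤ C * (Real.exp a * Ups (b - a) + Real.exp (-b) * Ups (b - a))) ∧
    ∀ t : ℝ, |t - b| ^ γ ≤ C * (Real.exp a * Ups (t - a) + Real.exp (-b) * Ups (b - t) +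
      (Real.exp a * Ups (b - a) + Real.exp (-b) * Ups (b - a))) := by
  obtain ⟨A, hA, h⟩ := aux_A γ hγ
  have h2 : (1:ℝ) ≤ 2 ^ γ := Real.one_le_rpow (by norm_num) (by linarith)
  refine ⟨2 ^ γ * A, by positivity, fun a b => ?_⟩
  have n1 := fun t => mul_nonneg (Real.exp_pos a).le (aux_Ups_nonneg t)
  have n2 := fun t => mul_nonneg (Real.exp_pos (-b)).le (aux_Ups_nonneg t)
  have hab : |a - b| ^ γ ≤ A * (Real.exp a * Ups (b - a) + Real.exp (-b) * Ups (b - a)) := by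
    rw [abs_sub_comm]
    rcases le_total 0 (a + b) with h0 | h0
    · refine (h a (b - a) ?_).trans (mul_le_mul_of_nonneg_left ?_ hA.le)
      · linarith [abs_nonneg (b - a)]
      · linarith [n2 (b - a)]
    · refine (h (-b) (b - a) ?_).trans (mul_le_mul_of_nonneg_left ?_ hA.le)
      · linarith [abs_nonneg (b - a)]
      · linarith [n1 (b - a)]
  set R := Real.exp a * Ups (b - a) + Real.exp (-b) * Ups (b - a) with hR
  have hR0 : 0 ≤ R := add_nonneg (n1 _) (n2 _)
  refine ⟨hab.trans ?_, fun t => ?_⟩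
  · rw [mul_assoc]
    exact le_mul_of_one_le_left (by positivity) h2
  have n1t := n1 (t - a)
  have n2t := n2 (b - t)
  rw [mul_assoc]
  by_cases c1 : -((t - a) / 2) - |t - a| / 4 ≤ a
  · have k1 := h a (t - a) c1
    calc |t - b| ^ γ ≤ (|t - a| + |a - b|) ^ γ :=
          Real.rpow_le_rpow (abs_nonneg _) (abs_sub_le _ _ _) (by linarith)
      _ ≤ 2 ^ γ * (|t - a| ^ γ + |a - b| ^ γ) :=
          aux_two γ hγ _ _ (abs_nonneg _) (abs_nonneg _)
      _ ≤ _ := mul_le_mul_of_nonneg_left (by nlinarith) (by positivity)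
  by_cases c2 : -((b - t) / 2) - |b - t| / 4 ≤ -b
  · have k1 := h (-b) (b - t) c2
    rw [abs_sub_comm]
    have k2 : A * (Real.exp (-b) * Ups (b - t)) ≤
      A * (Real.exp a * Ups (t - a) + Real.exp (-b) * Ups (b - t) + R) :=
        mul_le_mul_of_nonneg_left (by linarith) hA.le
    refine (k1.trans k2).trans (le_mul_of_one_le_left (by positivity) h2)
  · push Not at c1 c2
    have k0 : |t - b| ≤ 2 * |a - b| := by
      rw [abs_sub_comm t b, abs_sub_comm a b]
      have := le_abs_self (b - a)
      have := abs_nonneg (t - a)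
      linarith
    calc |t - b| ^ γ ≤ (2 * |a - b|) ^ γ :=
          Real.rpow_le_rpow (abs_nonneg _) k0 (by linarith)
      _ = 2 ^ γ * |a - b| ^ γ := Real.mul_rpow (by norm_num) (abs_nonneg _)
      _ ≤ _ := mul_le_mul_of_nonneg_left (by nlinarith) (by positivity)

lemma aux_k_nonneg (β : ℝ) (j : ℤ) : 0 ≤ kpow β j := by
  unfold kpow; split_ifs
  · exact le_rfl
  · positivity

lemma aux_k_summable (β : ℝ) (hβ : 1 < β) : Summable (kpow β) := by
  refine Summable.of_nonneg_of_le (aux_k_nonneg β) (fun j => ?_)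
    (Real.summable_abs_int_rpow (by linarith : 1 < 1 + β))
  unfold kpow; split_ifs
  · positivity
  · exact le_rfl

def auxT (β : ℝ) (u : ℤ → ℝ) (x : ℤ) (p : ℤ × ℤ) : ℝ :=
  kpow β p.1 * kpow β p.2 * Real.exp (u (x + p.2) - u x) *
    Ups (u (x + p.1 + p.2) - u (x + p.1) - u (x + p.2) + u x)

lemma auxT_nonneg (β : ℝ) (u : ℤ → ℝ) (x : ℤ) (p : ℤ × ℤ) : 0 ≤ auxT β u x p :=
  mul_nonneg (mul_nonneg (mul_nonneg (aux_k_nonneg _ _) (aux_k_nonneg _ _)) (Real.exp_pos _).le)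
    (aux_Ups_nonneg _)

lemma auxT_summable (β : ℝ) (hβ : 1 < β) (u : ℤ → ℝ) (hu : BddFun u) (x : ℤ) :
    Summable (auxT β u x) := by
  obtain ⟨M, hM⟩ := hu
  have hs := (aux_k_summable β hβ).mul_of_nonneg (aux_k_summable β hβ)
    (aux_k_nonneg β) (aux_k_nonneg β)
  refine Summable.of_nonneg_of_le (auxT_nonneg β u x) (fun p => ?_)
    (hs.mul_right (Real.exp (2 * M) * (Real.exp (4 * M) + 4 * M)))
  unfold auxT
  rw [mul_assoc (kpow β p.1 * kpow β p.2)]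
  apply mul_le_mul_of_nonneg_left _ (mul_nonneg (aux_k_nonneg _ _) (aux_k_nonneg _ _))
  have e1 := abs_le.1 (hM x)
  have e2 := abs_le.1 (hM (x + p.1))
  have e3 := abs_le.1 (hM (x + p.2))
  have e4 := abs_le.1 (hM (x + p.1 + p.2))
  apply mul_le_mul (Real.exp_le_exp.2 (by linarith)) _ (aux_Ups_nonneg _) (Real.exp_pos _).le
  unfold Ups
  have := Real.exp_le_exp.2 (by linarith :
    u (x + p.1 + p.2) - u (x + p.1) - u (x + p.2) + u x ≤ 4 * M)
  linarith

lemma auxT_tsum (β : ℝ) (u : ℤ → ℝ) (x : ℤ) :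
    ∑' p, auxT β u x p = 2 * Psi2 (kpow β) u x := by
  unfold Psi2 auxT; ring

lemma auxT_sum (β : ℝ) (hβ : 1 < β) (u : ℤ → ℝ) (hu : BddFun u) (x : ℤ) (I : Finset ℤ) (l : ℤ) :
    ∑ i ∈ I, auxT β u x (i, l) ≤ 2 * Psi2 (kpow β) u x := by
  rw [← auxT_tsum]
  have := (auxT_summable β hβ u hu x).sum_le_tsum (I ×ˢ {l})
    (fun p _ => auxT_nonneg β u x p)
  simpa [Finset.sum_product] using this

def auxm (β : ℝ) (i : ℤ) : ℝ := (1 + |(i:ℝ)|) ^ (-(1 + β))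

lemma auxm_pos (β : ℝ) (i : ℤ) : 0 < auxm β i := by unfold auxm; positivity

lemma auxm_le (β : ℝ) (hβ : 1 < β) (i j : ℤ) (hj : j ≠ 0) (h : |(j:ℝ)| ≤ 1 + |(i:ℝ)|) :
    auxm β i ≤ kpow β j := by
  unfold auxm kpow
  rw [if_neg hj]
  exact Real.rpow_le_rpow_of_nonpos (by positivity) h (by linarith)

lemma auxm_le1 (β : ℝ) (hβ : 1 < β) (i : ℤ) (hi : i ≠ 0) : auxm β i ≤ kpow β i :=
  auxm_le β hβ i i hi (by linarith)

lemma auxm_le2 (β : ℝ) (hβ : 1 < β) (i : ℤ) (hi : i ≠ -1) : auxm β i ≤ kpow β (i + 1) := by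
  refine auxm_le β hβ i (i + 1) (by omega) ?_
  push_cast
  have := abs_add_le (i:ℝ) 1
  rw [abs_one] at this
  linarith

lemma auxm_le3 (β : ℝ) (hβ : 1 < β) (i : ℤ) : auxm β i ≤ kpow β i + kpow β (i + 1) := by
  by_cases hi : i = 0
  · have := auxm_le2 β hβ i (by omega)
    linarith [aux_k_nonneg β i]
  · have := auxm_le1 β hβ i hi
    linarith [aux_k_nonneg β (i + 1)]

lemma auxm_summable (β : ℝ) (hβ : 1 < β) : Summable (auxm β) := by
  refine Summable.of_nonneg_of_le (fun i => (auxm_pos β i).le) (auxm_le3 β hβ) ?_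
  refine (aux_k_summable β hβ).add ?_
  exact (aux_k_summable β hβ).comp_injective (add_left_injective (1:ℤ))

lemma aux_k_one (β : ℝ) : kpow β 1 = 1 := by simp [kpow]
lemma aux_k_neg_one (β : ℝ) : kpow β (-1) = 1 := by simp [kpow]

/-- forward difference -/
def auxt (u : ℤ → ℝ) (x i : ℤ) : ℝ := u (x + i + 1) - u (x + i)

lemma aux_S (β γ : ℝ) (hβ : 1 < β) (hγ : 2 ≤ γ) : ∃ C : ℝ, 0 < C ∧
    ∀ u : ℤ → ℝ, BddFun u → ∀ x : ℤ, ∀ I : Finset ℤ,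
      ∑ i ∈ I, auxm β i * |auxt u x i - auxt u x (-1)| ^ γ ≤ C * Psi2 (kpow β) u x := by
  obtain ⟨C, hC, h⟩ := aux_pt γ hγ
  have hZ0 : 0 ≤ ∑' i, auxm β i := tsum_nonneg fun i => (auxm_pos β i).le
  refine ⟨C * (4 + 4 * ∑' i, auxm β i), by positivity, fun u hu x I => ?_⟩
  obtain ⟨hab, ht⟩ := h (auxt u x 0) (auxt u x (-1))
  have T1 : ∀ i, auxT β u x (i, 1) =
      kpow β i * (Real.exp (auxt u x 0) * Ups (auxt u x i - auxt u x 0)) := by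
    intro i
    simp only [auxT, auxt, aux_k_one, add_zero, mul_one]
    rw [mul_assoc]; congr 3; ring
  have T2 : ∀ i, auxT β u x (i + 1, -1) =
      kpow β (i + 1) * (Real.exp (-auxt u x (-1)) * Ups (auxt u x (-1) - auxt u x i)) := by
    intro i
    have e1 : x + (i + 1) + -1 = x + i := by ring
    have e2 : x + -1 + 1 = x := by ring
    have e3 : x + (i + 1) = x + i + 1 := by ring
    simp only [auxT, auxt, aux_k_neg_one, mul_one, e1, e2]
    rw [mul_assoc, e3]; congr 3 <;> ring
  set a := auxt u x 0
  set b := auxt u x (-1)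
  set R := Real.exp a * Ups (b - a) + Real.exp (-b) * Ups (b - a) with hR
  set P := Psi2 (kpow β) u x
  have hRP : R ≤ 4 * P := by
    have r1 := auxT_sum β hβ u hu x {-1} 1
    have r2 := auxT_sum β hβ u hu x {0 + 1} (-1)
    rw [Finset.sum_singleton, T1, aux_k_neg_one] at r1
    rw [Finset.sum_singleton, T2, zero_add, aux_k_one] at r2
    linarith
  have n1 := fun t => mul_nonneg (Real.exp_pos a).le (aux_Ups_nonneg t)
  have n2 := fun t => mul_nonneg (Real.exp_pos (-b)).le (aux_Ups_nonneg t)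
  have hR0 : 0 ≤ R := add_nonneg (n1 _) (n2 _)
  have key : ∀ i, auxm β i * |auxt u x i - b| ^ γ ≤
      C * (auxT β u x (i, 1) + auxT β u x (i + 1, -1) + auxm β i * R) := by
    intro i
    have hm := auxm_pos β i
    have p1 := auxT_nonneg β u x (i, 1)
    have p2 := auxT_nonneg β u x (i + 1, -1)
    by_cases h0 : i = 0
    · have : |auxt u x i - b| ^ γ ≤ C * R := by rw [h0]; exact hab
      calc _ ≤ auxm β i * (C * R) := mul_le_mul_of_nonneg_left this hm.le
        _ = C * (auxm β i * R) := by ring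
        _ ≤ _ := mul_le_mul_of_nonneg_left (by linarith) hC.le
    by_cases h1 : i = -1
    · have : |auxt u x i - b| ^ γ = 0 := by
        rw [h1, sub_self, abs_zero, Real.zero_rpow (by linarith)]
      rw [this, mul_zero]; positivity
    · have m1 := auxm_le1 β hβ i h0
      have m2 := auxm_le2 β hβ i h1
      calc _ ≤ auxm β i * (C * (Real.exp a * Ups (auxt u x i - a) +
              Real.exp (-b) * Ups (b - auxt u x i) + R)) :=
            mul_le_mul_of_nonneg_left (ht _) hm.le
        _ = C * (auxm β i * (Real.exp a * Ups (auxt u x i - a)) +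
              auxm β i * (Real.exp (-b) * Ups (b - auxt u x i)) + auxm β i * R) := by ring
        _ ≤ _ := by
            apply mul_le_mul_of_nonneg_left _ hC.le
            rw [T1, T2]
            have := mul_le_mul_of_nonneg_right m1 (n1 (auxt u x i - a))
            have := mul_le_mul_of_nonneg_right m2 (n2 (b - auxt u x i))
            linarith
  have s1 := auxT_sum β hβ u hu x I 1
  have s2 : ∑ i ∈ I, auxT β u x (i + 1, -1) ≤ 2 * P := by
    have := auxT_sum β hβ u hu x (I.image (· + 1)) (-1)
    rwa [Finset.sum_image (fun _ _ _ _ h => add_left_injective (1:ℤ) h)] at this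
  have s3 : ∑ i ∈ I, auxm β i ≤ ∑' i, auxm β i :=
    (auxm_summable β hβ).sum_le_tsum I fun i _ => (auxm_pos β i).le
  calc _ ≤ ∑ i ∈ I, C * (auxT β u x (i, 1) + auxT β u x (i + 1, -1) + auxm β i * R) :=
        Finset.sum_le_sum fun i _ => key i
    _ = C * (∑ i ∈ I, auxT β u x (i, 1) + ∑ i ∈ I, auxT β u x (i + 1, -1) +
          (∑ i ∈ I, auxm β i) * R) := by
        rw [← Finset.mul_sum, Finset.sum_add_distrib, Finset.sum_add_distrib, Finset.sum_mul]
    _ ≤ C * (2 * P + 2 * P + (∑' i, auxm β i) * (4 * P)) := by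
        apply mul_le_mul_of_nonneg_left _ hC.le
        have := mul_le_mul s3 hRP hR0 hZ0
        linarith
    _ = _ := by ring

lemma aux_D (u : ℤ → ℝ) (x : ℤ) (c : ℝ) (n : ℕ) :
    |u (x + n) + u (x - n) - 2 * u x| ≤
      ∑ i ∈ Finset.range n, (|auxt u x i - c| + |auxt u x (-1 - i) - c|) := by
  induction n with
  | zero =>
    simp only [Nat.cast_zero, add_zero, sub_zero, Finset.range_zero, Finset.sum_empty]
    rw [show u x + u x - 2 * u x = 0 by ring, abs_zero]
  | succ n ih =>
    rw [Finset.sum_range_succ]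
    refine le_trans ?_ (add_le_add_left ih _)
    have e : u (x + (n + 1 : ℕ)) + u (x - (n + 1 : ℕ)) - 2 * u x =
        (u (x + n) + u (x - n) - 2 * u x) + ((auxt u x n - c) - (auxt u x (-1 - n) - c)) := by
      unfold auxt
      have e1 : x + (n + 1 : ℕ) = x + n + 1 := by push_cast; ring
      have e2 : x - (n + 1 : ℕ) = x + (-1 - n) := by push_cast; ring
      have e3 : x + (-1 - (n:ℤ)) + 1 = x - n := by ring
      rw [e1, e2, e3]; ring
    rw [e]
    refine (abs_add_le _ _).trans ?_
    have := abs_sub (auxt u x n - c) (auxt u x (-1 - n) - c)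
    linarith

lemma aux_side (β γ C P : ℝ) (hβ : 1 < β) (u : ℤ → ℝ) (x : ℤ)
    (h : ∀ I : Finset ℤ, ∑ i ∈ I, auxm β i * |auxt u x i - auxt u x (-1)| ^ γ ≤ C * P)
    (n : ℕ) (e : ℕ → ℤ) (he : Function.Injective e) (hb : ∀ i < n, |(e i : ℝ)| ≤ n) :
    ∑ i ∈ Finset.range n, |auxt u x (e i) - auxt u x (-1)| ^ γ ≤
      (1 + (n:ℝ)) ^ (1 + β) * (C * P) := by
  have h1 := h ((Finset.range n).image e)
  rw [Finset.sum_image (fun _ _ _ _ h => he h)] at h1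
  have hp : 0 < (1 + (n:ℝ)) ^ (1 + β) := by positivity
  refine le_trans ?_ (mul_le_mul_of_nonneg_left h1 hp.le)
  rw [Finset.mul_sum]
  refine Finset.sum_le_sum fun i hi => ?_
  rw [← mul_assoc]
  apply le_mul_of_one_le_left (by positivity)
  unfold auxm
  have := Real.rpow_le_rpow_of_nonpos (by positivity : 0 < 1 + |(e i : ℝ)|)
    (by linarith [hb i (Finset.mem_range.1 hi)] : 1 + |(e i : ℝ)| ≤ 1 + n)
    (by linarith : -(1 + β) ≤ 0)
  calc (1:ℝ) = (1 + (n:ℝ)) ^ (1 + β) * (1 + (n:ℝ)) ^ (-(1 + β)) := by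
        rw [← Real.rpow_add (by positivity)]; simp
    _ ≤ _ := mul_le_mul_of_nonneg_left this hp.le

lemma aux_Dn (β γ : ℝ) (hβ : 1 < β) (hγ : 2 ≤ γ) : ∃ C : ℝ, 0 < C ∧
    ∀ u : ℤ → ℝ, BddFun u → ∀ x : ℤ, ∀ n : ℕ, n ≠ 0 →
      |u (x + n) + u (x - n) - 2 * u x| ^ γ ≤ C * Psi2 (kpow β) u x * (n:ℝ) ^ (γ + β) := by
  obtain ⟨C, hC, h⟩ := aux_S β γ hβ hγ
  refine ⟨2 ^ γ * 2 * 2 ^ (1 + β) * C, by positivity, fun u hu x n hn => ?_⟩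
  have hn1 : (1:ℝ) ≤ n := by exact_mod_cast Nat.one_le_iff_ne_zero.2 hn
  have hS := h u hu x
  set P := Psi2 (kpow β) u x
  have hCP : 0 ≤ C * P := by simpa using hS ∅
  have a1 := aux_side β γ C P hβ u x hS n (fun i => (i:ℤ)) (fun _ _ h => by simpa using h)
    (fun i hi => by
      simp only [Int.cast_natCast, Nat.abs_cast]
      exact_mod_cast hi.le)
  have a2 := aux_side β γ C P hβ u x hS n (fun i => -1 - (i:ℤ)) (fun _ _ h => by simpa using h)
    (fun i hi => by
      have : ((i:ℝ)) + 1 ≤ n := by exact_mod_cast hi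
      push_cast
      rw [abs_le]; constructor <;> linarith [(Nat.cast_nonneg i : (0:ℝ) ≤ i)])
  set b := auxt u x (-1)
  calc |u (x + n) + u (x - n) - 2 * u x| ^ γ
      ≤ (∑ i ∈ Finset.range n, (|auxt u x i - b| + |auxt u x (-1 - i) - b|)) ^ γ :=
        Real.rpow_le_rpow (abs_nonneg _) (aux_D u x b n) (by linarith)
    _ ≤ (n:ℝ) ^ (γ - 1) * ∑ i ∈ Finset.range n,
          (|auxt u x i - b| + |auxt u x (-1 - i) - b|) ^ γ := by
        have := Real.rpow_sum_le_const_mul_sum_rpow_of_nonneg (Finset.range n)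
          (f := fun i : ℕ => |auxt u x i - b| + |auxt u x (-1 - i) - b|) (p := γ)
          (by linarith) (fun i _ => by positivity)
        simpa using this
    _ ≤ (n:ℝ) ^ (γ - 1) * ∑ i ∈ Finset.range n,
          2 ^ γ * (|auxt u x i - b| ^ γ + |auxt u x (-1 - i) - b| ^ γ) := by
        apply mul_le_mul_of_nonneg_left _ (by positivity)
        exact Finset.sum_le_sum fun i _ => aux_two γ hγ _ _ (abs_nonneg _) (abs_nonneg _)
    _ = (n:ℝ) ^ (γ - 1) * (2 ^ γ * (∑ i ∈ Finset.range n, |auxt u x i - b| ^ γ +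
          ∑ i ∈ Finset.range n, |auxt u x (-1 - i) - b| ^ γ)) := by
        rw [← Finset.mul_sum, Finset.sum_add_distrib]
    _ ≤ (n:ℝ) ^ (γ - 1) * (2 ^ γ * ((2 ^ (1 + β) * (n:ℝ) ^ (1 + β)) * (C * P) +
          (2 ^ (1 + β) * (n:ℝ) ^ (1 + β)) * (C * P))) := by
        have q : (1 + (n:ℝ)) ^ (1 + β) ≤ 2 ^ (1 + β) * (n:ℝ) ^ (1 + β) := by
          rw [← Real.mul_rpow (by norm_num) (by positivity)]
          exact Real.rpow_le_rpow (by positivity) (by linarith) (by linarith)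
        have q' := mul_le_mul_of_nonneg_right q hCP
        apply mul_le_mul_of_nonneg_left _ (by positivity)
        apply mul_le_mul_of_nonneg_left _ (by positivity)
        exact add_le_add (a1.trans q') (a2.trans q')
    _ = 2 ^ γ * 2 * 2 ^ (1 + β) * C * P * ((n:ℝ) ^ (γ - 1) * (n:ℝ) ^ (1 + β)) := by ring
    _ = _ := by
        rw [← Real.rpow_add (by linarith)]; congr 2; ring

lemma aux_main (β γ : ℝ) (hβ : 1 < β) (hγ : 2 ≤ γ) (hβγ : 1 < β * (1 - 1 / γ)) :
    ∃ d : ℝ, 0 < d ∧ ∀ u : ℤ → ℝ, BddFun u → ∀ x : ℤ,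
      |Lop (kpow β) u x| ^ γ ≤ d * Psi2 (kpow β) u x := by
  obtain ⟨C, hC, h⟩ := aux_Dn β γ hβ hγ
  have hZs := Real.summable_abs_int_rpow hβγ
  set Z := ∑' j : ℤ, |(j:ℝ)| ^ (-(β * (1 - 1 / γ))) with hZ
  have hZ0 : 0 ≤ Z := tsum_nonneg fun j => by positivity
  have hk := aux_k_summable β hβ
  refine ⟨C * (Z ^ γ + 1), by positivity, fun u hu x => ?_⟩
  have hP : 0 ≤ Psi2 (kpow β) u x := by
    have := auxT_sum β hβ u hu x ∅ 1
    simp at this; exact this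
  have hD := h u hu x
  set P := Psi2 (kpow β) u x
  set Q := (C * P) ^ (1 / γ) with hQ
  have hQ0 : 0 ≤ Q := by positivity
  -- summability
  have s1 : Summable fun j : ℤ => kpow β j * (u (x + j) - u x) := by
    obtain ⟨M, hM⟩ := hu
    refine Summable.of_norm_bounded (hk.mul_right (2 * M)) fun j => ?_
    rw [Real.norm_eq_abs, abs_mul, abs_of_nonneg (aux_k_nonneg β j)]
    apply mul_le_mul_of_nonneg_left _ (aux_k_nonneg β j)
    have e1 := abs_le.1 (hM x)
    have e2 := abs_le.1 (hM (x + j))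
    rw [abs_le]; constructor <;> linarith
  have ksymm : ∀ j, kpow β (-j) = kpow β j := fun j => by simp [kpow]
  have s2 : Summable fun j : ℤ => kpow β j * (u (x - j) - u x) := by
    have := (Equiv.neg ℤ).summable_iff.2 s1
    refine this.congr fun j => ?_
    simp [ksymm, sub_eq_add_neg]
  have e2 : ∑' j : ℤ, kpow β j * (u (x - j) - u x) = Lop (kpow β) u x := by
    unfold Lop
    rw [← (Equiv.neg ℤ).tsum_eq fun j : ℤ => kpow β j * (u (x + j) - u x)]
    refine tsum_congr fun j => ?_
    simp [ksymm, sub_eq_add_neg]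
  have e3 : 2 * Lop (kpow β) u x = ∑' j : ℤ, kpow β j * (u (x + j) + u (x - j) - 2 * u x) := by
    have := s1.tsum_add s2
    rw [e2] at this
    have e4 : ∑' j : ℤ, kpow β j * (u (x + j) - u x) = Lop (kpow β) u x := rfl
    rw [e4] at this
    rw [two_mul, ← this]
    refine tsum_congr fun j => ?_
    ring
  have bd : ∀ j : ℤ, ‖kpow β j * (u (x + j) + u (x - j) - 2 * u x)‖ ≤
      Q * |(j:ℝ)| ^ (-(β * (1 - 1 / γ))) := by
    intro j
    rw [Real.norm_eq_abs, abs_mul, abs_of_nonneg (aux_k_nonneg β j)]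
    by_cases hj : j = 0
    · simp only [hj, kpow, if_true, zero_mul]; positivity
    have hjn : j.natAbs ≠ 0 := by omega
    have e5 : u (x + j) + u (x - j) = u (x + j.natAbs) + u (x - j.natAbs) := by
      rcases Int.natAbs_eq j with h | h
      · rw [← h]
      · have h' : (j.natAbs : ℤ) = -j := by omega
        rw [h', sub_neg_eq_add, add_comm, sub_eq_add_neg]
    have e6 : ((j.natAbs : ℕ) : ℝ) = |(j:ℝ)| := by
      rw [Nat.cast_natAbs]; simp
    have hd := hD j.natAbs hjn
    rw [e6, ← e5] at hd
    have hjp : 0 < |(j:ℝ)| := by positivity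
    have hd2 : |u (x + j) + u (x - j) - 2 * u x| ≤ Q * |(j:ℝ)| ^ ((γ + β) / γ) := by
      have := Real.rpow_le_rpow (by positivity) hd (by positivity : 0 ≤ 1 / γ)
      rw [← Real.rpow_mul (abs_nonneg _), mul_one_div_cancel (by linarith), Real.rpow_one,
        Real.mul_rpow (by positivity) (by positivity), ← Real.rpow_mul (abs_nonneg _)] at this
      rwa [mul_one_div] at this
    calc _ ≤ kpow β j * (Q * |(j:ℝ)| ^ ((γ + β) / γ)) :=
          mul_le_mul_of_nonneg_left hd2 (aux_k_nonneg β j)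
      _ = Q * (|(j:ℝ)| ^ (-(1 + β)) * |(j:ℝ)| ^ ((γ + β) / γ)) := by
          unfold kpow; rw [if_neg hj]; ring
      _ = _ := by
          rw [← Real.rpow_add hjp]
          congr 2
          have : γ ≠ 0 := by linarith
          field_simp; ring
  have hL : |2 * Lop (kpow β) u x| ≤ Q * Z := by
    rw [e3, hZ, ← tsum_mul_left]
    exact tsum_of_norm_bounded (hZs.mul_left Q).hasSum bd
  have hL' : |Lop (kpow β) u x| ≤ Q * Z := by
    rw [abs_mul, abs_two] at hL
    linarith [abs_nonneg (Lop (kpow β) u x)]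
  calc |Lop (kpow β) u x| ^ γ ≤ (Q * Z) ^ γ :=
        Real.rpow_le_rpow (abs_nonneg _) hL' (by linarith)
    _ = C * P * Z ^ γ := by
        rw [Real.mul_rpow hQ0 hZ0, hQ, ← Real.rpow_mul (by positivity),
          one_div_mul_cancel (by linarith), Real.rpow_one]
    _ ≤ C * (Z ^ γ + 1) * P := by
        have : 0 ≤ C * P := by positivity
        linarith

/-- Corollary (power-type kernel, moment estimate): for `β > 1`, `α ∈ (1,2]` with `α < β` and
`γ = α/(α−1)`, there is `d > 0` such that `Ψ_{2,Υ}(u)(x) ≥ (1/d)|L_β u(x)|^γ` for all bounded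
`u` and all `x`; in particular `L_β` satisfies `CD_Υ(0,F)` with `F(r) = (1/d) r^γ`. -/
theorem powertype_moment_CD (β α γ : ℝ) (hβ : 1 < β) (hα1 : 1 < α) (hα2 : α ≤ 2)
    (hαβ : α < β) (hγ : γ = α / (α - 1)) :
    ∃ d : ℝ, 0 < d ∧
      (∀ u : ℤ → ℝ, BddFun u → ∀ x : ℤ,
        (1 / d) * |Lop (kpow β) u x| ^ γ ≤ Psi2 (kpow β) u x) ∧
      CDUps (kpow β) (fun r => (1 / d) * r ^ γ) := by
  have hα0 : 0 < α - 1 := by linarith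
  have hγ2 : 2 ≤ γ := by rw [hγ, le_div_iff₀ hα0]; linarith
  have hx : 1 < β * (1 - 1 / γ) := by
    have : 1 - 1 / γ = 1 / α := by
      rw [hγ]; field_simp; ring
    rw [this, mul_one_div, one_lt_div (by linarith)]
    exact hαβ
  obtain ⟨d, hd, h⟩ := aux_main β γ hβ hγ2 hx
  have key : ∀ u : ℤ → ℝ, BddFun u → ∀ x : ℤ,
      (1 / d) * |Lop (kpow β) u x| ^ γ ≤ Psi2 (kpow β) u x := by
    intro u hu x
    rw [one_div, inv_mul_le_iff₀ hd]
    exact h u hu x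
  refine ⟨d, hd, key, fun u hu x hL => ?_⟩
  have := key u hu x
  rw [← abs_neg, abs_of_nonneg hL] at this
  exact this
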